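/- arXiv:2604.11069 — 10 statements merged into one kernel-verified Lean document; each statement's English description precedes it below -/
import Mathlib

section
/- (Theorem 1, marginal post-SIC noise density on success, negative tail.) Let Ω > 0, σ > 0, X > 0, and let w ≤ 0. Then ∫₀^∞ (2b/Ω) e^{-b²/Ω} · (∫_ℝ f_N(n)·𝟙[−X b ≤ n ≤ w] dn) db = ∫_{-∞}^{w} f_N(n) · e^{-n²/(X²Ω)} dn. (Equivalently, for independent β Rayleigh(Ω) and N Gaussian(0,σ²), the joint probability P(N ≤ w and Xβ + N ≥ 0) equals the right-hand side, which establishes that the unnormalized density of the post-SIC noise W = N conditioned on a successful SIC is f_N(w)·e^{-w²/(X²Ω)} for w < 0.) -/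
open MeasureTheory Real Filter Set

noncomputable def Phi (x : ℝ) : ℝ :=
  ∫ t in Set.Iic x, (Real.sqrt (2 * Real.pi))⁻¹ * Real.exp (-t ^ 2 / 2)

noncomputable def Q (x : ℝ) : ℝ := 1 - Phi x

noncomputable def gaussPDF (σ n : ℝ) : ℝ :=
  (σ * Real.sqrt (2 * Real.pi))⁻¹ * Real.exp (-n ^ 2 / (2 * σ ^ 2))

noncomputable def E1 (x : ℝ) : ℝ := ∫ t in Set.Ioi x, Real.exp (-t) / t


theorem rayleigh_tail (Ω a : ℝ) (hΩ : 0 < Ω) (ha : 0 ≤ a) :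
    IntegrableOn (fun b : ℝ => (2 * b / Ω) * Real.exp (-b ^ 2 / Ω)) (Set.Ioi a) ∧
    ∫ b in Set.Ioi a, (2 * b / Ω) * Real.exp (-b ^ 2 / Ω) = Real.exp (-a ^ 2 / Ω) := by
  have hd : ∀ x ∈ Set.Ici a, HasDerivAt (fun b : ℝ => -Real.exp (-b ^ 2 / Ω))
      ((2 * x / Ω) * Real.exp (-x ^ 2 / Ω)) x := by
    intro x _
    have h := ((((hasDerivAt_id x).pow 2).neg.div_const Ω).exp).neg
    refine h.congr_deriv ?_
    simp only [id, Pi.pow_apply, Pi.neg_apply]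
    push_cast
    ring
  have hnn : ∀ x ∈ Set.Ioi a, 0 ≤ (2 * x / Ω) * Real.exp (-x ^ 2 / Ω) := by
    intro x hx
    have : 0 < x := lt_of_le_of_lt ha hx
    positivity
  have ht : Tendsto (fun b : ℝ => -Real.exp (-b ^ 2 / Ω)) atTop (nhds 0) := by
    have h1 : Tendsto (fun b : ℝ => b ^ 2 / Ω) atTop atTop :=
      (tendsto_pow_atTop two_ne_zero).atTop_div_const hΩ
    have h2 := (Real.tendsto_exp_neg_atTop_nhds_zero.comp h1).neg
    simpa [Function.comp_def, neg_div] using h2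
  refine ⟨integrableOn_Ioi_deriv_of_nonneg' hd hnn ht, ?_⟩
  rw [integral_Ioi_of_hasDerivAt_of_nonneg' hd hnn ht]
  simp

theorem gaussPDF_integrable (σ : ℝ) (hσ : 0 < σ) : Integrable (gaussPDF σ) := by
  unfold gaussPDF
  apply Integrable.const_mul
  have h := integrable_exp_neg_mul_sq (b := 1 / (2 * σ ^ 2)) (by positivity)
  refine h.congr (Eventually.of_forall fun x => ?_)
  simp only
  congr 1
  ring

theorem postSIC_noise_success_marginal (Ω σ X w : ℝ)
    (hΩ : 0 < Ω) (hσ : 0 < σ) (hX : 0 < X) (hw : w ≤ 0) :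
    (∫ b in Set.Ioi (0:ℝ), (2 * b / Ω) * Real.exp (-b ^ 2 / Ω) *
        (∫ n in Set.Icc (-(X * b)) w, gaussPDF σ n))
      = ∫ n in Set.Iic w, gaussPDF σ n * Real.exp (-n ^ 2 / (X ^ 2 * Ω)) := by
  set r : ℝ → ℝ := fun b => (2 * b / Ω) * Real.exp (-b ^ 2 / Ω) with hr
  have hS : MeasurableSet {p : ℝ × ℝ | -(X * p.1) ≤ p.2} :=
    measurableSet_le (by fun_prop) (by fun_prop)
  have hint : Integrable (Function.uncurry fun b n : ℝ =>
      {p : ℝ × ℝ | -(X * p.1) ≤ p.2}.indicator (fun p => r p.1 * gaussPDF σ p.2) (b, n))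
      ((volume.restrict (Set.Ioi (0:ℝ))).prod (volume.restrict (Set.Iic w))) := by
    have h1 : Integrable r (volume.restrict (Set.Ioi (0:ℝ))) := (rayleigh_tail Ω 0 hΩ le_rfl).1
    have h2 : Integrable (gaussPDF σ) (volume.restrict (Set.Iic w)) :=
      (gaussPDF_integrable σ hσ).restrict
    exact (h1.mul_prod h2).indicator hS
  have hswap := integral_integral_swap hint
  have hL : ∀ b : ℝ, r b * (∫ n in Set.Icc (-(X * b)) w, gaussPDF σ n) =
      ∫ n in Set.Iic w,
        {p : ℝ × ℝ | -(X * p.1) ≤ p.2}.indicator (fun p => r p.1 * gaussPDF σ p.2) (b, n) := by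
    intro b
    have : ∀ n : ℝ, {p : ℝ × ℝ | -(X * p.1) ≤ p.2}.indicator
        (fun p => r p.1 * gaussPDF σ p.2) (b, n) =
        (Set.Ici (-(X * b))).indicator (fun n => r b * gaussPDF σ n) n := by
      intro n
      simp [Set.indicator]
    simp_rw [this]
    rw [setIntegral_indicator measurableSet_Ici, Set.inter_comm, Set.Ici_inter_Iic,
      integral_const_mul]
  have hR : ∀ n ∈ Set.Iic w, (∫ b in Set.Ioi (0:ℝ),
        {p : ℝ × ℝ | -(X * p.1) ≤ p.2}.indicator (fun p => r p.1 * gaussPDF σ p.2) (b, n)) =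
      gaussPDF σ n * Real.exp (-n ^ 2 / (X ^ 2 * Ω)) := by
    intro n hn
    have hn0 : n ≤ 0 := le_trans hn hw
    have ha : 0 ≤ -n / X := div_nonneg (by linarith) hX.le
    have : ∀ b : ℝ, {p : ℝ × ℝ | -(X * p.1) ≤ p.2}.indicator
        (fun p => r p.1 * gaussPDF σ p.2) (b, n) =
        (Set.Ici (-n / X)).indicator (fun b => gaussPDF σ n * r b) b := by
      intro b
      have : (-(X * b) ≤ n) ↔ (-n / X ≤ b) := by
        rw [div_le_iff₀ hX]
        constructor <;> intro h <;> linarith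
      simp [Set.indicator, this, mul_comm]
    simp_rw [this]
    rw [← integral_Ici_eq_integral_Ioi, setIntegral_indicator measurableSet_Ici,
      Set.Ici_inter_Ici, sup_eq_right.mpr ha, integral_const_mul, integral_Ici_eq_integral_Ioi,
      (rayleigh_tail Ω _ hΩ ha).2]
    congr 2
    field_simp
  refine (integral_congr_ae (Eventually.of_forall hL)).trans ?_
  rw [hswap]
  exact setIntegral_congr_fun measurableSet_Iic hR
end

section
/- (Theorem 1, marginal post-SIC noise density on failure.) Let Ω > 0, σ > 0, X > 0, and let w ≤ 0. Then ∫₀^∞ (2b/Ω) e^{-b²/Ω} · (∫_{-∞}^{min(w, −X b)} f_N(n) dn) db = ∫_{-∞}^{w} f_N(n) · (1 − e^{-n²/(X²Ω)}) dn. (Equivalently, for independent β Rayleigh(Ω) and N Gaussian(0,σ²), P(N ≤ w and Xβ + N < 0) equals the right-hand side, which establishes that the unnormalized density of the post-SIC noise Z = N conditioned on a SIC failure is f_N(z)·(1 − e^{-z²/(X²Ω)}) for z < 0 and vanishes for z ≥ 0.) -/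
open MeasureTheory Real Filter Set

/-- Theorem 1 (failure case): P(N ≤ w and Xβ + N < 0) equals the integral of
f_N(n)·(1 − e^{-n²/(X²Ω)}) over (-∞, w], establishing the unnormalized
post-SIC noise density after a SIC failure. -/
theorem postSIC_noise_failure_marginal (Ω σ X w : ℝ)
    (hΩ : 0 < Ω) (hσ : 0 < σ) (hX : 0 < X) (hw : w ≤ 0) :
    (∫ b in Set.Ioi (0:ℝ), (2 * b / Ω) * Real.exp (-b ^ 2 / Ω) *
        (∫ n in Set.Iic (min w (-(X * b))), gaussPDF σ n))
      = ∫ n in Set.Iic w, gaussPDF σ n * (1 - Real.exp (-n ^ 2 / (X ^ 2 * Ω))) := by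
  have hg : Integrable (fun n => gaussPDF σ n) := by
    have h := (integrable_exp_neg_mul_sq (b := 1 / (2 * σ ^ 2)) (by positivity)).const_mul
      (σ * Real.sqrt (2 * Real.pi))⁻¹
    refine h.congr (ae_of_all _ fun n => ?_)
    simp only [gaussPDF]
    congr 2
    ring
  have hr : Integrable (fun b : ℝ => (2 * b / Ω) * Real.exp (-b ^ 2 / Ω)) := by
    have h := (integrable_mul_exp_neg_mul_sq (b := 1 / Ω) (by positivity)).const_mul (2 / Ω)
    refine h.congr (ae_of_all _ fun n => ?_)
    have : -(1 / Ω) * n ^ 2 = -n ^ 2 / Ω := by ring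
    simp only [this]
    ring
  let S : Set (ℝ × ℝ) := {p | p.2 ≤ w ∧ X * p.1 ≤ -p.2}
  have hS : MeasurableSet S := by
    apply MeasurableSet.inter
    · exact measurableSet_le measurable_snd measurable_const
    · exact measurableSet_le (measurable_fst.const_mul X) measurable_snd.neg
  let F : ℝ × ℝ → ℝ := S.indicator
    (fun p => ((2 * p.1 / Ω) * Real.exp (-p.1 ^ 2 / Ω)) * gaussPDF σ p.2)
  have hF : Integrable F ((volume.restrict (Set.Ioi (0:ℝ))).prod volume) :=
    ((hr.restrict (s := Set.Ioi 0)).mul_prod hg).indicator hS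
  have hswap := integral_integral_swap (f := fun b n => F (b, n)) hF
  have h1 : ∀ b : ℝ, (2 * b / Ω) * Real.exp (-b ^ 2 / Ω) *
        (∫ n in Set.Iic (min w (-(X * b))), gaussPDF σ n) = ∫ n, F (b, n) := by
    intro b
    rw [← integral_const_mul, ← integral_indicator measurableSet_Iic]
    congr 1
    ext n
    simp only [F, S, Set.indicator, Set.mem_Iic, Set.mem_setOf_eq, le_min_iff, le_neg]
  have hFTC : ∀ c : ℝ, 0 ≤ c → ∫ b in Set.Ioc 0 c, (2 * b / Ω) * Real.exp (-b ^ 2 / Ω)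
      = 1 - Real.exp (-c ^ 2 / Ω) := by
    intro c hc
    rw [← intervalIntegral.integral_of_le hc,
      intervalIntegral.integral_eq_sub_of_hasDerivAt (f := fun b => - Real.exp (-b ^ 2 / Ω))]
    · simp; ring
    · intro x _
      have := (((hasDerivAt_pow 2 x).neg.div_const Ω).exp).neg
      refine HasDerivAt.congr_deriv (f := fun b => - Real.exp (-b ^ 2 / Ω)) this ?_
      simp only [Pi.neg_apply]
      push_cast
      ring
    · exact hr.intervalIntegrable
  simp_rw [h1]
  rw [hswap, ← integral_indicator measurableSet_Iic]
  congr 1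
  ext n
  by_cases hn : n ≤ w
  · rw [Set.indicator_of_mem (by exact hn)]
    have hc : 0 ≤ -n / X := div_nonneg (by linarith) hX.le
    have e := hFTC _ hc
    have : -(-n / X) ^ 2 / Ω = -n ^ 2 / (X ^ 2 * Ω) := by field_simp
    rw [this] at e
    rw [← e, ← integral_const_mul, ← integral_indicator measurableSet_Ioi,
      ← integral_indicator measurableSet_Ioc]
    congr 1
    ext b
    have hb : b ≤ -n / X ↔ X * b ≤ -n := by rw [le_div_iff₀ hX, mul_comm]
    simp only [F, S, Set.indicator, Set.mem_Ioi, Set.mem_Ioc, Set.mem_setOf_eq, hb, hn, true_and]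
    by_cases h0 : 0 < b <;> by_cases h2 : X * b ≤ -n <;> simp [h0, h2, mul_comm]
  · rw [Set.indicator_of_notMem (by exact hn)]
    simp [F, S, Set.indicator, hn]
end

section
/- (Second moment of the post-SIC noise after a successful SIC.) Let Ω > 0, σ > 0, X ≠ 0, and set γ̄ = Ω/σ². Then ∫₀^∞ w² f_N(w) dw + ∫_{-∞}^0 w² f_N(w) e^{-w²/(X²Ω)} dw = (σ²/2)·(1 + |X|³·(γ̄/(γ̄ X² + 2))^{3/2}). Consequently, with p_S = 1/2 + (1/2)√(X²γ̄/(X²γ̄+2)), the second moment of the success-conditioned noise W with density f_W(w) = f_N(w)/p_S for w ≥ 0 and f_W(w) = f_N(w) e^{-w²/(X²Ω)}/p_S for w < 0 satisfies E[W²] = (σ²/(2 p_S))·(1 + |X|³·(γ̄/(γ̄ X² + 2))^{3/2}). -/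
open MeasureTheory Real Filter Set

lemma aux_int (s : ℝ) (hs : 0 < s) :
    ∫ w in Set.Ioi (0:ℝ), w ^ 2 * Real.exp (-w ^ 2 / (2 * s ^ 2)) =
      s ^ 3 * Real.sqrt (2 * Real.pi) / 2 := by
  have h := integral_rpow_mul_exp_neg_mul_rpow (p := 2) (q := 2) (b := 1 / (2 * s ^ 2))
    (by norm_num) (by norm_num) (by positivity)
  have e : ∀ w : ℝ, w ^ 2 * Real.exp (-w ^ 2 / (2 * s ^ 2)) =
      w ^ (2:ℝ) * Real.exp (-(1 / (2 * s ^ 2)) * w ^ (2:ℝ)) := by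
    intro w
    rw [Real.rpow_two]
    congr 2
    ring
  simp_rw [e]
  rw [h]
  have g : Real.Gamma ((2 + 1) / 2) = Real.sqrt Real.pi / 2 := by
    rw [show ((2:ℝ) + 1) / 2 = 1 / 2 + 1 by norm_num, Real.Gamma_add_one (by norm_num),
      Real.Gamma_one_half_eq]
    ring
  have k : (1 / (2 * s ^ 2)) ^ (-((2:ℝ) + 1) / 2) = (Real.sqrt 2 * s) ^ 3 := by
    have : 1 / (2 * s ^ 2) = (Real.sqrt 2 * s) ^ (-2:ℝ) := by
      rw [Real.rpow_neg (by positivity), Real.rpow_two, mul_pow, Real.sq_sqrt (by norm_num)]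
      simp
    rw [this, ← Real.rpow_mul (by positivity), ← Real.rpow_natCast]
    norm_num
  rw [g, k, Real.sqrt_mul (by norm_num)]
  have := Real.sq_sqrt (show (0:ℝ) ≤ 2 by norm_num)
  linear_combination (Real.sqrt 2 * s ^ 3 * Real.sqrt Real.pi / 4) * this

lemma aux_integrable (s c : ℝ) (hs : 0 < s) :
    Integrable (fun w : ℝ => w ^ 2 * (c * Real.exp (-w ^ 2 / (2 * s ^ 2)))) := by
  have h := (integrable_rpow_mul_exp_neg_mul_sq (b := 1 / (2 * s ^ 2)) (by positivity)
    (s := 2) (by norm_num)).const_mul c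
  refine h.congr (Eventually.of_forall fun w => ?_)
  simp only [Real.rpow_two]
  rw [show -(1 / (2 * s ^ 2)) * w ^ 2 = -w ^ 2 / (2 * s ^ 2) by ring]
  ring

/-- Second moment of the post-SIC noise after a successful SIC. -/
theorem success_noise_second_moment (Ω σ X γbar pS : ℝ) (fW : ℝ → ℝ)
    (hΩ : 0 < Ω) (hσ : 0 < σ) (hX : X ≠ 0) (hγ : γbar = Ω / σ ^ 2)
    (hpS : pS = 1 / 2 + (1 / 2) * Real.sqrt (X ^ 2 * γbar / (X ^ 2 * γbar + 2)))
    (hfW : ∀ w, fW w = if 0 ≤ w then gaussPDF σ w / pS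
        else gaussPDF σ w * Real.exp (-w ^ 2 / (X ^ 2 * Ω)) / pS) :
    ((∫ w in Set.Ioi (0:ℝ), w ^ 2 * gaussPDF σ w) +
        ∫ w in Set.Iic (0:ℝ), w ^ 2 * gaussPDF σ w * Real.exp (-w ^ 2 / (X ^ 2 * Ω)))
      = σ ^ 2 / 2 * (1 + |X| ^ 3 * (γbar / (γbar * X ^ 2 + 2)) ^ ((3:ℝ) / 2)) ∧
    (∫ w : ℝ, w ^ 2 * fW w)
      = σ ^ 2 / (2 * pS) * (1 + |X| ^ 3 * (γbar / (γbar * X ^ 2 + 2)) ^ ((3:ℝ) / 2)) := by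
  have hγ0 : 0 < γbar := by rw [hγ]; positivity
  have hX0 : 0 < |X| := abs_pos.mpr hX
  have hX2 : 0 < X ^ 2 := by positivity
  set r : ℝ := Real.sqrt (γbar / (γbar * X ^ 2 + 2)) with hr
  have hr0 : 0 < r := Real.sqrt_pos.mpr (by positivity)
  have hr2 : r ^ 2 = γbar / (γbar * X ^ 2 + 2) := Real.sq_sqrt (by positivity)
  have hpow : (γbar / (γbar * X ^ 2 + 2)) ^ ((3:ℝ) / 2) = r ^ 3 := by
    rw [← hr2, ← Real.rpow_natCast, ← Real.rpow_natCast, ← Real.rpow_mul hr0.le]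
    norm_num
  rw [hpow]
  have hpS0 : 0 < pS := by rw [hpS]; positivity
  set c : ℝ := (σ * Real.sqrt (2 * Real.pi))⁻¹ with hc
  set s : ℝ := σ * |X| * r with hs
  have hs0 : 0 < s := by positivity
  have hs2 : s ^ 2 = σ ^ 2 * X ^ 2 * (γbar / (γbar * X ^ 2 + 2)) := by
    rw [hs, mul_pow, mul_pow, sq_abs, hr2]
  have hneg : ∀ w : ℝ, gaussPDF σ w * Real.exp (-w ^ 2 / (X ^ 2 * Ω)) =
      c * Real.exp (-w ^ 2 / (2 * s ^ 2)) := by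
    intro w
    rw [gaussPDF, mul_assoc, ← Real.exp_add, hs2, hγ]
    congr 2
    field_simp
    ring
  have hpos : ∀ w : ℝ, gaussPDF σ w = c * Real.exp (-w ^ 2 / (2 * σ ^ 2)) := fun w => rfl
  have hsq : 0 < Real.sqrt (2 * Real.pi) := by positivity
  have I1 : ∫ w in Set.Ioi (0:ℝ), w ^ 2 * gaussPDF σ w = σ ^ 2 / 2 := by
    simp_rw [hpos, mul_left_comm _ c]
    rw [integral_const_mul, aux_int σ hσ, hc]
    field_simp
  have I2 : ∫ w in Set.Iic (0:ℝ), w ^ 2 * gaussPDF σ w * Real.exp (-w ^ 2 / (X ^ 2 * Ω)) =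
      σ ^ 2 / 2 * (|X| ^ 3 * r ^ 3) := by
    simp_rw [mul_assoc, hneg, mul_left_comm _ c]
    rw [integral_const_mul]
    have := integral_comp_neg_Ioi (0:ℝ) (fun w : ℝ => w ^ 2 * Real.exp (-w ^ 2 / (2 * s ^ 2)))
    simp only [neg_sq, neg_zero] at this
    rw [← this, aux_int s hs0, hc, hs]
    field_simp
  have main : ((∫ w in Set.Ioi (0:ℝ), w ^ 2 * gaussPDF σ w) +
        ∫ w in Set.Iic (0:ℝ), w ^ 2 * gaussPDF σ w * Real.exp (-w ^ 2 / (X ^ 2 * Ω)))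
      = σ ^ 2 / 2 * (1 + |X| ^ 3 * r ^ 3) := by
    rw [I1, I2]; ring
  refine ⟨main, ?_⟩
  have A1 : ∀ w ∈ Set.Ioi (0:ℝ), w ^ 2 * fW w = w ^ 2 * gaussPDF σ w / pS := by
    intro w hw
    rw [hfW, if_pos (le_of_lt hw)]; ring
  have A2 : ∀ w ∈ Set.Iio (0:ℝ), w ^ 2 * fW w =
      w ^ 2 * gaussPDF σ w * Real.exp (-w ^ 2 / (X ^ 2 * Ω)) / pS := by
    intro w hw
    rw [hfW, if_neg (not_le.mpr hw)]; ring
  have A2' : ∀ w ∈ Set.Iic (0:ℝ), w ^ 2 * fW w =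
      w ^ 2 * gaussPDF σ w * Real.exp (-w ^ 2 / (X ^ 2 * Ω)) / pS := by
    intro w hw
    rcases eq_or_lt_of_le (Set.mem_Iic.mp hw) with h | h
    · simp [h]
    · exact A2 w h
  have J1 : IntegrableOn (fun w => w ^ 2 * fW w) (Set.Ioi 0) := by
    refine IntegrableOn.congr_fun ?_ (fun w hw => (A1 w hw).symm) measurableSet_Ioi
    exact ((aux_integrable σ c hσ).div_const pS).integrableOn
  have J2 : IntegrableOn (fun w => w ^ 2 * fW w) (Set.Iic 0) := by
    refine IntegrableOn.congr_fun ?_ (fun w hw => (A2' w hw).symm) measurableSet_Iic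
    simp_rw [mul_assoc, hneg]
    exact ((aux_integrable s c hs0).div_const pS).integrableOn
  rw [← intervalIntegral.integral_Iic_add_Ioi J2 J1,
    setIntegral_congr_fun measurableSet_Iic A2', setIntegral_congr_fun measurableSet_Ioi A1,
    integral_div, integral_div, I1, I2]
  field_simp
  ring
end

section
/- (Second moment of the post-SIC noise after a SIC failure.) Let Ω > 0, σ > 0, X ≠ 0, and set γ̄ = Ω/σ². Then ∫_{-∞}^0 z² f_N(z)·(1 − e^{-z²/(X²Ω)}) dz = (σ²/2)·(1 − |X|³·(γ̄/(2 + γ̄ X²))^{3/2}). Consequently, with p_F = 1 − p_S = 1/2 − (1/2)√(X²γ̄/(X²γ̄+2)), the failure-conditioned noise Z with density f_Z(z) = f_N(z)(1 − e^{-z²/(X²Ω)})/p_F for z < 0 (and 0 for z ≥ 0) satisfies E[Z²] = (σ²/(2 p_F))·(1 − |X|³·(γ̄/(2 + γ̄ X²))^{3/2}). -/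
open MeasureTheory Real Filter Set

lemma aux_int_s6 (b : ℝ) (hb : 0 < b) :
    IntegrableOn (fun z : ℝ => z ^ 2 * Real.exp (-b * z ^ 2)) (Set.Iic 0) ∧
    ∫ z in Set.Iic (0:ℝ), z ^ 2 * Real.exp (-b * z ^ 2) = √π / 4 * b ^ (-(3:ℝ) / 2) := by
  constructor
  · have h := integrable_rpow_mul_exp_neg_mul_sq hb (s := 2) (by norm_num)
    have h2 : Integrable (fun z : ℝ => z ^ 2 * Real.exp (-b * z ^ 2)) := by
      simpa using h
    exact h2.integrableOn
  · have h := integral_rpow_mul_exp_neg_mul_rpow (p := 2) (q := 2) (b := b)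
      (by norm_num) (by norm_num) hb
    have h3 : Real.Gamma ((2 + 1) / 2) = √π / 2 := by
      rw [show ((2:ℝ) + 1) / 2 = 1 / 2 + 1 by norm_num, Real.Gamma_add_one (by norm_num),
        Real.Gamma_one_half_eq]
      ring
    rw [h3] at h
    have h4 := integral_comp_neg_Ioi (0:ℝ) (fun z : ℝ => z ^ 2 * Real.exp (-b * z ^ 2))
    simp only [neg_zero, even_two.neg_pow] at h4
    rw [← h4]
    simp only [Real.rpow_two] at h
    rw [h, show -((2:ℝ) + 1) / 2 = -(3:ℝ) / 2 by norm_num]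
    ring

/-- Second moment of the post-SIC noise after a SIC failure. -/
theorem failure_noise_second_moment (Ω σ X γbar pF : ℝ) (fZ : ℝ → ℝ)
    (hΩ : 0 < Ω) (hσ : 0 < σ) (hX : X ≠ 0) (hγ : γbar = Ω / σ ^ 2)
    (hpF : pF = 1 / 2 - (1 / 2) * Real.sqrt (X ^ 2 * γbar / (X ^ 2 * γbar + 2)))
    (hfZ : ∀ z, fZ z = if z < 0 then
        gaussPDF σ z * (1 - Real.exp (-z ^ 2 / (X ^ 2 * Ω))) / pF else 0) :
    (∫ z in Set.Iic (0:ℝ), z ^ 2 * gaussPDF σ z * (1 - Real.exp (-z ^ 2 / (X ^ 2 * Ω))))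
      = σ ^ 2 / 2 * (1 - |X| ^ 3 * (γbar / (2 + γbar * X ^ 2)) ^ ((3:ℝ) / 2)) ∧
    (∫ z : ℝ, z ^ 2 * fZ z)
      = σ ^ 2 / (2 * pF) * (1 - |X| ^ 3 * (γbar / (2 + γbar * X ^ 2)) ^ ((3:ℝ) / 2)) := by
  have key : (∫ z in Set.Iic (0:ℝ), z ^ 2 * gaussPDF σ z * (1 - Real.exp (-z ^ 2 / (X ^ 2 * Ω))))
      = σ ^ 2 / 2 * (1 - |X| ^ 3 * (γbar / (2 + γbar * X ^ 2)) ^ ((3:ℝ) / 2)) := by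
    have hX2 : 0 < X ^ 2 := by positivity
    have hγ0 : 0 < γbar := by rw [hγ]; positivity
    set r : ℝ := X ^ 2 * (γbar / (2 + γbar * X ^ 2)) with hr
    have hr0 : 0 < r := by positivity
    have hX3 : |X| ^ 3 * (γbar / (2 + γbar * X ^ 2)) ^ ((3:ℝ) / 2) = r ^ ((3:ℝ) / 2) := by
      rw [hr, Real.mul_rpow hX2.le (by positivity)]
      congr 1
      rw [← sq_abs, ← Real.rpow_natCast, ← Real.rpow_natCast, ← Real.rpow_mul (abs_nonneg X)]
      norm_num
    rw [hX3]
    set b : ℝ := (2 * σ ^ 2)⁻¹ with hb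
    have hb0 : 0 < b := by positivity
    obtain ⟨i1, e1⟩ := aux_int_s6 b hb0
    obtain ⟨i2, e2⟩ := aux_int_s6 (b * r⁻¹) (by positivity)
    have hbr : b * r⁻¹ = b + (X ^ 2 * Ω)⁻¹ := by
      rw [hr, hb, hγ]; field_simp; ring
    have hfun : ∀ z : ℝ, z ^ 2 * gaussPDF σ z * (1 - Real.exp (-z ^ 2 / (X ^ 2 * Ω)))
        = (σ * √(2 * π))⁻¹ * (z ^ 2 * Real.exp (-b * z ^ 2)
          - z ^ 2 * Real.exp (-(b * r⁻¹) * z ^ 2)) := by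
      intro z
      have ha : -(b * r⁻¹) * z ^ 2 = -b * z ^ 2 + -z ^ 2 / (X ^ 2 * Ω) := by
        rw [hbr]; ring
      have hc : -z ^ 2 / (2 * σ ^ 2) = -b * z ^ 2 := by rw [hb]; ring
      rw [ha, Real.exp_add, gaussPDF, hc]; ring
    simp_rw [hfun]
    rw [integral_const_mul, integral_sub i1 i2, e1, e2,
      Real.mul_rpow hb0.le (by positivity), Real.inv_rpow hr0.le,
      show -(3:ℝ) / 2 = -(3 / 2) by ring, Real.rpow_neg hr0.le, inv_inv]
    have hb3 : b ^ (-((3:ℝ) / 2)) = 2 * σ ^ 2 * (√2 * σ) := by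
      rw [Real.rpow_neg hb0.le, hb, Real.inv_rpow (by positivity), inv_inv,
        show (3:ℝ) / 2 = 1 + 1 / 2 by norm_num, Real.rpow_add (by positivity), Real.rpow_one,
        ← Real.sqrt_eq_rpow, Real.sqrt_mul (by norm_num), Real.sqrt_sq hσ.le]
    rw [hb3, Real.sqrt_mul (by norm_num)]
    have : √π ≠ 0 := by positivity
    field_simp
    ring
  refine ⟨key, ?_⟩
  have h2 : ∀ z : ℝ, z ^ 2 * fZ z = (Set.Iic (0:ℝ)).indicator (fun z => pF⁻¹ *
      (z ^ 2 * gaussPDF σ z * (1 - Real.exp (-z ^ 2 / (X ^ 2 * Ω))))) z := by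
    intro z
    rw [hfZ]
    rcases lt_trichotomy z 0 with h | h | h
    · rw [if_pos h, Set.indicator_of_mem (Set.mem_Iic.2 h.le)]; ring
    · subst h; simp
    · rw [if_neg h.not_gt, Set.indicator_of_notMem (by simpa using h)]; ring
  simp_rw [h2]
  rw [integral_indicator measurableSet_Iic, integral_const_mul, key, div_mul_eq_div_div]
  ring
end

section
/- (Closed-form CDF of the success-conditioned fading gain, i.e. the outage probability P_{O_S} up to the normalization p_S.) Let Ω > 0, σ > 0, X > 0, γ̄ = Ω/σ², φ = √(X²γ̄/(X²γ̄+2)), and ε ≥ 0. Then ∫₀^ε (2b/Ω) Φ(X b/σ) e^{-b²/Ω} db = 1/2 − e^{-ε²/Ω}·Φ(ε√(γ̄X²/Ω)) + φ·(Φ(ε√((γ̄X² + 2)/Ω)) − 1/2). In particular, dividing by p_S = (1+φ)/2 gives the outage probability of the near user conditioned on a successful SIC, P_{O_S} = ∫₀^ε f_{β_S}(b) db with f_{β_S}(b) = (2b/(Ω p_S)) Φ(Xb/σ) e^{-b²/Ω}. -/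
open MeasureTheory Real Filter Set

noncomputable def gpdf (t : ℝ) : ℝ := (Real.sqrt (2 * Real.pi))⁻¹ * Real.exp (-t ^ 2 / 2)

lemma gpdf_cont : Continuous gpdf := by
  unfold gpdf; fun_prop

lemma gpdf_int : Integrable gpdf := by
  have h := (integrable_exp_neg_mul_sq (b := 1/2) (by norm_num)).const_mul (Real.sqrt (2 * Real.pi))⁻¹
  refine h.congr (Eventually.of_forall fun t => ?_)
  simp only [gpdf]
  congr 2; ring

lemma Phi_zero : Phi 0 = 1 / 2 := by
  have h1 : Phi 0 = ∫ t in Set.Iic (0:ℝ), (fun u => gpdf u) (-t) := by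
    unfold Phi
    refine integral_congr_ae (Eventually.of_forall fun t => ?_)
    simp [gpdf]
  rw [h1, integral_comp_neg_Iic (0:ℝ) (fun u => gpdf u)]
  have h2 : (∫ t in Set.Ioi (-0:ℝ), gpdf t)
      = ∫ t in Set.Ioi (0:ℝ), (Real.sqrt (2 * Real.pi))⁻¹ * Real.exp (-(1/2) * t ^ 2) := by
    rw [neg_zero]
    refine integral_congr_ae (Eventually.of_forall fun t => ?_)
    simp only [gpdf]
    congr 2; ring
  rw [h2, integral_const_mul, integral_gaussian_Ioi]
  have : Real.pi / (1/2) = 2 * Real.pi := by ring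
  rw [this]
  have : Real.sqrt (2 * Real.pi) ≠ 0 := by positivity
  field_simp

lemma Phi_deriv (x : ℝ) : HasDerivAt Phi (gpdf x) x := by
  have h : Phi = fun y => Phi 0 + ∫ t in (0:ℝ)..y, gpdf t := by
    funext y
    have := intervalIntegral.integral_Iic_sub_Iic (μ := volume) (f := gpdf) (a := 0) (b := y)
      gpdf_int.integrableOn gpdf_int.integrableOn
    rw [← this]
    simp only [Phi, gpdf]; ring
  rw [h]
  exact (intervalIntegral.integral_hasDerivAt_right (gpdf_cont.intervalIntegrable _ _)
    (gpdf_cont.stronglyMeasurableAtFilter _ _) gpdf_cont.continuousAt).const_add _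

/-- Closed-form CDF of the success-conditioned fading gain (outage probability
P_{O_S} up to the normalization p_S). -/
theorem outage_cdf_success (Ω σ X γbar φ ε : ℝ)
    (hΩ : 0 < Ω) (hσ : 0 < σ) (hX : 0 < X) (hγ : γbar = Ω / σ ^ 2)
    (hφ : φ = Real.sqrt (X ^ 2 * γbar / (X ^ 2 * γbar + 2))) (hε : 0 ≤ ε) :
    (∫ b in (0:ℝ)..ε, (2 * b / Ω) * Phi (X * b / σ) * Real.exp (-b ^ 2 / Ω))
      = 1 / 2 - Real.exp (-ε ^ 2 / Ω) * Phi (ε * Real.sqrt (γbar * X ^ 2 / Ω))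
        + φ * (Phi (ε * Real.sqrt ((γbar * X ^ 2 + 2) / Ω)) - 1 / 2) := by
  have hγ0 : 0 < γbar := by rw [hγ]; positivity
  have ha : Real.sqrt (γbar * X ^ 2 / Ω) = X / σ := by
    rw [show γbar * X ^ 2 / Ω = (X / σ) ^ 2 by rw [hγ]; field_simp]
    exact Real.sqrt_sq (by positivity)
  set s := Real.sqrt ((γbar * X ^ 2 + 2) / Ω) with hs
  have hs2 : s ^ 2 = X ^ 2 / σ ^ 2 + 2 / Ω := by
    rw [hs, Real.sq_sqrt (by positivity), hγ]; field_simp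
  have hφs : φ * s = X / σ := by
    rw [hφ, hs, ← Real.sqrt_mul (by positivity), ← ha]
    congr 1
    field_simp
  rw [ha]
  have hPc : Continuous Phi := continuous_iff_continuousAt.2 fun x => (Phi_deriv x).continuousAt
  have key : ∀ b : ℝ, HasDerivAt
      (fun b => -(Real.exp (-b ^ 2 / Ω) * Phi (X * b / σ)) + φ * Phi (b * s))
      ((2 * b / Ω) * Phi (X * b / σ) * Real.exp (-b ^ 2 / Ω)) b := by
    intro b
    have e1 : HasDerivAt (fun b : ℝ => Real.exp (-b ^ 2 / Ω))
        (Real.exp (-b ^ 2 / Ω) * (-(2 * b) / Ω)) b := by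
      have := (((hasDerivAt_id b).pow 2).neg.div_const Ω).exp
      simpa using this
    have e2 : HasDerivAt (fun b : ℝ => Phi (X * b / σ)) (gpdf (X * b / σ) * (X / σ)) b := by
      have h0 : HasDerivAt (fun b : ℝ => X * b / σ) (X / σ) b := by
        simpa using ((hasDerivAt_id b).const_mul X).div_const σ
      exact (Phi_deriv _).comp b h0
    have e3 : HasDerivAt (fun b : ℝ => Phi (b * s)) (gpdf (b * s) * s) b := by
      have h0 : HasDerivAt (fun b : ℝ => b * s) s b := by
        simpa using (hasDerivAt_id b).mul_const s
      exact (Phi_deriv _).comp b h0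
    have hg : gpdf (b * s) = Real.exp (-b ^ 2 / Ω) * gpdf (X * b / σ) := by
      unfold gpdf
      rw [mul_left_comm, ← Real.exp_add]
      congr 2
      rw [mul_pow, hs2]; field_simp; ring
    refine ((e1.mul e2).neg.add (e3.const_mul φ)).congr_deriv ?_
    rw [hg]
    linear_combination (Real.exp (-b ^ 2 / Ω) * gpdf (X * b / σ)) * hφs
  rw [intervalIntegral.integral_eq_sub_of_hasDerivAt (fun b _ => key b)
    (Continuous.intervalIntegrable (by fun_prop) _ _)]
  rw [show X * ε / σ = ε * (X / σ) by ring]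
  simp [Phi_zero]
  ring
end

section
/- (Closed-form CDF of the failure-conditioned fading gain, i.e. the outage probability P_{O_F} up to the normalization p_F.) Let Ω > 0, σ > 0, X > 0, γ̄ = Ω/σ², φ = √(X²γ̄/(X²γ̄+2)), and ε ≥ 0. Then ∫₀^ε (2b/Ω) e^{-b²/Ω} Q(X b/σ) db = 1/2 − e^{-ε²/Ω}·Q(X ε/σ) − φ·(Φ(ε√((X²γ̄ + 2)/Ω)) − 1/2). Equivalently, writing erf(x) = 2Φ(x√2) − 1, the last term equals (φ/2)·erf(ε√((X²γ̄+2)/(2Ω))). Dividing by p_F = (1−φ)/2 gives the outage probability of the near user conditioned on a SIC failure, P_{O_F} = ∫₀^ε f_{β_F}(b) db with f_{β_F}(b) = (2b/(Ω p_F)) e^{-b²/Ω} Q(Xb/σ). -/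
open MeasureTheory Real Filter Set

lemma aux_cont : Continuous (fun t : ℝ => (Real.sqrt (2 * Real.pi))⁻¹ * Real.exp (-t ^ 2 / 2)) := by
  fun_prop

lemma aux_int_s8 : Integrable (fun t : ℝ => (Real.sqrt (2 * Real.pi))⁻¹ * Real.exp (-t ^ 2 / 2)) := by
  have h := (integrable_exp_neg_mul_sq (b := 1/2) (by norm_num)).const_mul (Real.sqrt (2 * Real.pi))⁻¹
  refine h.congr (Filter.Eventually.of_forall fun t => ?_)
  simp only
  congr 2
  ring

lemma Phi_deriv_s8 (x : ℝ) :
    HasDerivAt Phi ((Real.sqrt (2 * Real.pi))⁻¹ * Real.exp (-x ^ 2 / 2)) x := by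
  have h : Phi = fun x => Phi 0 +
      ∫ t in (0:ℝ)..x, (Real.sqrt (2 * Real.pi))⁻¹ * Real.exp (-t ^ 2 / 2) := by
    funext y
    have := intervalIntegral.integral_Iic_sub_Iic (a := 0) (b := y) aux_int_s8.integrableOn
      aux_int_s8.integrableOn
    rw [← this]
    unfold Phi
    ring
  rw [h]
  exact (aux_cont.integral_hasStrictDerivAt 0 x).hasDerivAt.const_add _

/-- Closed-form CDF of the failure-conditioned fading gain (outage probability
P_{O_F} up to the normalization p_F), together with the erf rewriting of the last
term, where erf(x) = 2Φ(x√2) − 1. -/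
theorem outage_cdf_failure (Ω σ X γbar φ ε : ℝ)
    (hΩ : 0 < Ω) (hσ : 0 < σ) (hX : 0 < X) (hγ : γbar = Ω / σ ^ 2)
    (hφ : φ = Real.sqrt (X ^ 2 * γbar / (X ^ 2 * γbar + 2))) (hε : 0 ≤ ε) :
    (∫ b in (0:ℝ)..ε, (2 * b / Ω) * Real.exp (-b ^ 2 / Ω) * Q (X * b / σ))
      = 1 / 2 - Real.exp (-ε ^ 2 / Ω) * Q (X * ε / σ)
        - φ * (Phi (ε * Real.sqrt ((X ^ 2 * γbar + 2) / Ω)) - 1 / 2) ∧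
    φ * (Phi (ε * Real.sqrt ((X ^ 2 * γbar + 2) / Ω)) - 1 / 2)
      = φ / 2 * (2 * Phi (ε * Real.sqrt ((X ^ 2 * γbar + 2) / (2 * Ω)) * Real.sqrt 2) - 1) := by
  have hg : 0 < γbar := by rw [hγ]; positivity
  set s := Real.sqrt ((X ^ 2 * γbar + 2) / Ω) with hs
  have hs2 : s ^ 2 = X ^ 2 / σ ^ 2 + 2 / Ω := by
    rw [hs, Real.sq_sqrt (by positivity), hγ]
    field_simp
  have hφs : φ * s = X / σ := by
    rw [hφ, hs, ← Real.sqrt_mul (by positivity)]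
    rw [show X ^ 2 * γbar / (X ^ 2 * γbar + 2) * ((X ^ 2 * γbar + 2) / Ω) = (X / σ) ^ 2 by
      have : X ^ 2 * γbar + 2 ≠ 0 := by positivity
      rw [div_mul_div_cancel₀ this, hγ]
      field_simp]
    exact Real.sqrt_sq (by positivity)
  constructor
  · have hd : ∀ b : ℝ, HasDerivAt
        (fun b => -(Real.exp (-b ^ 2 / Ω) * Q (X * b / σ)) - φ * Phi (b * s))
        ((2 * b / Ω) * Real.exp (-b ^ 2 / Ω) * Q (X * b / σ)) b := by
      intro b
      have e1 : HasDerivAt (fun b : ℝ => Real.exp (-b ^ 2 / Ω))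
          (Real.exp (-b ^ 2 / Ω) * (-(2 * b) / Ω)) b := by
        have := (((hasDerivAt_id b).pow 2).neg.div_const Ω).exp
        simpa using this
      have e2 : HasDerivAt (fun b : ℝ => Q (X * b / σ))
          (-((Real.sqrt (2 * Real.pi))⁻¹ * Real.exp (-(X * b / σ) ^ 2 / 2) * (X / σ))) b := by
        have l : HasDerivAt (fun b : ℝ => X * b / σ) (X / σ) b := by
          simpa using ((hasDerivAt_id b).const_mul X).div_const σ
        exact ((Phi_deriv_s8 (X * b / σ)).comp b l).const_sub 1
      have e3 : HasDerivAt (fun b : ℝ => Phi (b * s))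
          ((Real.sqrt (2 * Real.pi))⁻¹ * Real.exp (-(b * s) ^ 2 / 2) * s) b := by
        have l : HasDerivAt (fun b : ℝ => b * s) s b := by
          simpa using (hasDerivAt_id b).mul_const s
        exact (Phi_deriv_s8 (b * s)).comp b l
      have he : Real.exp (-(b * s) ^ 2 / 2)
          = Real.exp (-b ^ 2 / Ω) * Real.exp (-(X * b / σ) ^ 2 / 2) := by
        rw [← Real.exp_add]
        congr 1
        rw [mul_pow, hs2]
        field_simp
        ring
      refine ((e1.mul e2).neg.sub (e3.const_mul φ)).congr_deriv ?_
      rw [he, ← hφs]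
      ring
    have hPc : Continuous Phi := continuous_iff_continuousAt.2 fun x => (Phi_deriv_s8 x).continuousAt
    have hQc : Continuous Q := continuous_const.sub hPc
    rw [intervalIntegral.integral_eq_sub_of_hasDerivAt (fun b _ => hd b)
      (Continuous.intervalIntegrable (by fun_prop) _ _)]
    simp only [Q, mul_zero, zero_mul, zero_div, Phi_zero, ne_eq, OfNat.ofNat_ne_zero,
      not_false_eq_true, zero_pow, neg_zero, Real.exp_zero]
    ring
  · rw [mul_assoc ε, ← Real.sqrt_mul (by positivity),
      show (X ^ 2 * γbar + 2) / (2 * Ω) * 2 = (X ^ 2 * γbar + 2) / Ω by field_simp]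
    ring
end

section
/- (Legacy outage probability with the imperfect-SIC factor.) Let Ω > 0, σ > 0, γ_th > 0, α₁ ≥ 0, α₂ > 0, ζ ≥ 0 with α₂ > ζ α₁ γ_th, and set γ̄ = Ω/σ². Then ∫₀^∞ (2b/Ω) e^{-b²/Ω} · 𝟙[ α₂ b² / (ζ α₁ b² + σ²) < γ_th ] db = 1 − exp( − (γ_th/γ̄) / (α₂ − ζ α₁ γ_th) ). Moreover, if α₂ ≤ ζ α₁ γ_th, the left-hand side equals 1. -/
open MeasureTheory

lemma ray_deriv (Ω : ℝ) (hΩ : 0 < Ω) (x : ℝ) :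
    HasDerivAt (fun b : ℝ => -Real.exp (-b ^ 2 / Ω)) ((2 * x / Ω) * Real.exp (-x ^ 2 / Ω)) x := by
  have h := ((((hasDerivAt_pow 2 x).neg).div_const Ω).exp).neg
  refine h.congr_deriv ?_
  simp
  ring

lemma ray_cond (σ γth k α₂ x : ℝ) (hσ : 0 < σ) (hk : 0 ≤ k) :
    α₂ * x ^ 2 / (k * x ^ 2 + σ ^ 2) < γth ↔ x ^ 2 * (α₂ - k * γth) < γth * σ ^ 2 := by
  rw [div_lt_iff₀ (by positivity)]
  constructor <;> intro h <;> nlinarith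

/-- Legacy outage probability with the imperfect-SIC factor ζ. -/
theorem legacy_outage_probability (Ω σ γth α₁ α₂ ζ γbar : ℝ)
    (hΩ : 0 < Ω) (hσ : 0 < σ) (hth : 0 < γth) (h1 : 0 ≤ α₁) (h2 : 0 < α₂)
    (hζ : 0 ≤ ζ) (hγ : γbar = Ω / σ ^ 2) :
    (α₂ > ζ * α₁ * γth →
      (∫ b in Set.Ioi (0:ℝ), (2 * b / Ω) * Real.exp (-b ^ 2 / Ω) *
          Set.indicator {x : ℝ | α₂ * x ^ 2 / (ζ * α₁ * x ^ 2 + σ ^ 2) < γth}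
            (fun _ => (1:ℝ)) b)
        = 1 - Real.exp (-(γth / γbar) / (α₂ - ζ * α₁ * γth))) ∧
    (α₂ ≤ ζ * α₁ * γth →
      (∫ b in Set.Ioi (0:ℝ), (2 * b / Ω) * Real.exp (-b ^ 2 / Ω) *
          Set.indicator {x : ℝ | α₂ * x ^ 2 / (ζ * α₁ * x ^ 2 + σ ^ 2) < γth}
            (fun _ => (1:ℝ)) b)
        = 1) := by
  have hk : 0 ≤ ζ * α₁ := mul_nonneg hζ h1
  constructor
  · intro hlt
    have hd : 0 < α₂ - ζ * α₁ * γth := by linarith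
    set T := Real.sqrt (γth * σ ^ 2 / (α₂ - ζ * α₁ * γth)) with hT
    have hT2 : T ^ 2 = γth * σ ^ 2 / (α₂ - ζ * α₁ * γth) := Real.sq_sqrt (by positivity)
    have hT0 : 0 ≤ T := Real.sqrt_nonneg _
    have e : ∀ b ∈ Set.Ioi (0:ℝ), (2 * b / Ω) * Real.exp (-b ^ 2 / Ω) *
          Set.indicator {x : ℝ | α₂ * x ^ 2 / (ζ * α₁ * x ^ 2 + σ ^ 2) < γth}
            (fun _ => (1:ℝ)) b =
        Set.indicator (Set.Iio T) (fun b => (2 * b / Ω) * Real.exp (-b ^ 2 / Ω)) b := by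
      intro b hb
      have hb : 0 < b := hb
      have key : α₂ * b ^ 2 / (ζ * α₁ * b ^ 2 + σ ^ 2) < γth ↔ b < T := by
        rw [ray_cond σ γth _ α₂ b hσ hk, hT, Real.lt_sqrt hb.le, lt_div_iff₀ hd]
      simp only [Set.indicator_apply, Set.mem_setOf_eq, Set.mem_Iio, key]
      split_ifs <;> simp
    rw [setIntegral_congr_fun measurableSet_Ioi e, setIntegral_indicator measurableSet_Iio,
      Set.Ioi_inter_Iio, ← integral_Ioc_eq_integral_Ioo,
      ← intervalIntegral.integral_of_le hT0,
      intervalIntegral.integral_eq_sub_of_hasDerivAt (fun x _ => ray_deriv Ω hΩ x)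
        (Continuous.intervalIntegrable (by fun_prop) _ _)]
    have : -T ^ 2 / Ω = -(γth / γbar) / (α₂ - ζ * α₁ * γth) := by
      rw [hT2, hγ]
      field_simp
    rw [this]
    simp
    ring
  · intro hle
    have e : ∀ b ∈ Set.Ioi (0:ℝ), (2 * b / Ω) * Real.exp (-b ^ 2 / Ω) *
          Set.indicator {x : ℝ | α₂ * x ^ 2 / (ζ * α₁ * x ^ 2 + σ ^ 2) < γth}
            (fun _ => (1:ℝ)) b = (2 * b / Ω) * Real.exp (-b ^ 2 / Ω) := by
      intro b hb
      have key : α₂ * b ^ 2 / (ζ * α₁ * b ^ 2 + σ ^ 2) < γth := by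
        rw [ray_cond σ γth _ α₂ b hσ hk]
        have : 0 < γth * σ ^ 2 := by positivity
        have : b ^ 2 * (α₂ - ζ * α₁ * γth) ≤ 0 :=
          mul_nonpos_of_nonneg_of_nonpos (sq_nonneg b) (by linarith)
        linarith
      rw [Set.indicator_of_mem (by exact key), mul_one]
    rw [setIntegral_congr_fun measurableSet_Ioi e]
    have hlim : Filter.Tendsto (fun b : ℝ => -Real.exp (-b ^ 2 / Ω)) Filter.atTop (nhds 0) := by
      rw [← neg_zero]
      refine (Real.tendsto_exp_atBot.comp ?_).neg
      refine Filter.Tendsto.atBot_div_const hΩ ?_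
      exact Filter.tendsto_neg_atTop_atBot.comp (Filter.tendsto_pow_atTop two_ne_zero)
    rw [integral_Ioi_of_hasDerivAt_of_nonneg' (fun x _ => ray_deriv Ω hΩ x) ?_ hlim]
    · simp
    · intro x hx
      have hx : 0 < x := hx
      positivity
end

section
/- (Legacy ergodic capacity with the imperfect-SIC factor.) Let Ω > 0, σ > 0, α₁ > 0, α₂ > 0, ζ > 0, and set γ̄ = Ω/σ², A = (1/γ̄)/(ζα₁ + α₂), B = (1/γ̄)/(ζα₁). Then ∫₀^∞ log₂( 1 + α₂ b² / (ζ α₁ b² + σ²) ) · (2b/Ω) e^{-b²/Ω} db = (1/ln 2)·( e^{A} E₁(A) − e^{B} E₁(B) ), where E₁(x) = ∫_x^∞ e^{-t}/t dt is the exponential integral. -/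
open MeasureTheory Real Filter Set

lemma E1_int {a : ℝ} (ha : 0 < a) : IntegrableOn (fun t => Real.exp (-t) / t) (Set.Ioi a) := by
  have h := (integrableOn_exp_neg_Ioi a).div_const a
  refine Integrable.mono' h ?_ ?_
  · exact (by fun_prop : Measurable (fun t : ℝ => Real.exp (-t) / t)).aestronglyMeasurable
  · filter_upwards [ae_restrict_mem measurableSet_Ioi] with t ht
    have ht' : a < t := ht
    have : 0 < t := ha.trans ht'
    rw [Real.norm_of_nonneg (by positivity)]
    gcongr

lemma E1_deriv {x : ℝ} (hx : 0 < x) : HasDerivAt E1 (-(Real.exp (-x) / x)) x := by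
  have hev : E1 =ᶠ[nhds x] fun y => E1 (x/2) - ∫ t in (x/2)..y, Real.exp (-t) / t := by
    filter_upwards [lt_mem_nhds (show x/2 < x by linarith)] with y hy
    have := intervalIntegral.integral_Ioi_sub_Ioi (E1_int (half_pos hx)) hy.le
    unfold E1
    linarith
  refine HasDerivAt.congr_of_eventuallyEq ?_ hev
  refine HasDerivAt.const_sub _ ?_
  apply intervalIntegral.integral_hasDerivAt_right
  · rw [intervalIntegrable_iff_integrableOn_Ioc_of_le (by linarith)]
    exact (E1_int (half_pos hx)).mono_set Ioc_subset_Ioi_self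
  · exact (by fun_prop : Measurable (fun t : ℝ => Real.exp (-t) / t)).stronglyMeasurable.stronglyMeasurableAtFilter
  · exact ContinuousAt.div (by fun_prop) (by fun_prop) hx.ne'

lemma E1_lim : Tendsto E1 atTop (nhds 0) := by
  have h := tendsto_integral_Ioi_zero (f := fun t : ℝ => Real.exp (-t) / t) (μ := volume) (l := atTop) (b := fun x : ℝ => x) tendsto_id
  exact h

/-- Legacy ergodic capacity with the imperfect-SIC factor ζ. -/
theorem legacy_ergodic_capacity (Ω σ α₁ α₂ ζ γbar A B : ℝ)
    (hΩ : 0 < Ω) (hσ : 0 < σ) (h1 : 0 < α₁) (h2 : 0 < α₂) (hζ : 0 < ζ)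
    (hγ : γbar = Ω / σ ^ 2)
    (hA : A = (1 / γbar) / (ζ * α₁ + α₂)) (hB : B = (1 / γbar) / (ζ * α₁)) :
    (∫ b in Set.Ioi (0:ℝ),
        Real.logb 2 (1 + α₂ * b ^ 2 / (ζ * α₁ * b ^ 2 + σ ^ 2)) *
          ((2 * b / Ω) * Real.exp (-b ^ 2 / Ω)))
      = (1 / Real.log 2) * (Real.exp A * E1 A - Real.exp B * E1 B) := by
  have hA0 : 0 < A := by rw [hA, hγ]; positivity
  have hB0 : 0 < B := by rw [hB, hγ]; positivity
  have hl2 : 0 < Real.log 2 := Real.log_pos (by norm_num)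
  have key := integral_Ioi_of_hasDerivAt_of_nonneg' (a := 0) (l := 0)
    (g := fun b : ℝ => -(Real.log (1 + α₂ * b ^ 2 / (ζ * α₁ * b ^ 2 + σ ^ 2)) * Real.exp (-b ^ 2 / Ω))
      - Real.exp A * E1 (A + b ^ 2 / Ω) + Real.exp B * E1 (B + b ^ 2 / Ω))
    (g' := fun b : ℝ => Real.log (1 + α₂ * b ^ 2 / (ζ * α₁ * b ^ 2 + σ ^ 2)) *
          ((2 * b / Ω) * Real.exp (-b ^ 2 / Ω))) ?_ ?_ ?_
  · have e : ∀ b : ℝ, Real.logb 2 (1 + α₂ * b ^ 2 / (ζ * α₁ * b ^ 2 + σ ^ 2)) *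
          ((2 * b / Ω) * Real.exp (-b ^ 2 / Ω)) = (1 / Real.log 2) * (Real.log (1 + α₂ * b ^ 2 / (ζ * α₁ * b ^ 2 + σ ^ 2)) *
          ((2 * b / Ω) * Real.exp (-b ^ 2 / Ω))) := by
      intro b; rw [Real.logb]; ring
    simp_rw [e]
    rw [integral_const_mul, key]
    have z : Real.log (1 + α₂ * 0 ^ 2 / (ζ * α₁ * 0 ^ 2 + σ ^ 2)) = 0 := by simp
    have z1 : (0:ℝ) ^ 2 / Ω = 0 := by simp
    rw [z, z1, add_zero, add_zero]
    ring
  · intro b _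
    have hD : 0 < ζ * α₁ * b ^ 2 + σ ^ 2 := by positivity
    have hsq : HasDerivAt (fun b : ℝ => b ^ 2) (2 * b) b := by simpa using hasDerivAt_pow 2 b
    have hw : HasDerivAt (fun b : ℝ => b ^ 2 / Ω) (2 * b / Ω) b := hsq.div_const Ω
    have hEx : HasDerivAt (fun b : ℝ => Real.exp (-b ^ 2 / Ω)) (Real.exp (-b ^ 2 / Ω) * (-(2 * b) / Ω)) b :=
      (hsq.neg.div_const Ω).exp
    have hu : HasDerivAt (fun b : ℝ => 1 + α₂ * b ^ 2 / (ζ * α₁ * b ^ 2 + σ ^ 2))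
        (((α₂ * (2 * b)) * (ζ * α₁ * b ^ 2 + σ ^ 2) - α₂ * b ^ 2 * (ζ * α₁ * (2 * b))) / (ζ * α₁ * b ^ 2 + σ ^ 2) ^ 2) b :=
      ((hsq.const_mul α₂).div ((hsq.const_mul (ζ * α₁)).add_const (σ ^ 2)) hD.ne').const_add 1
    have hL := hu.log (by positivity)
    have hEA : HasDerivAt (fun b : ℝ => E1 (A + b ^ 2 / Ω)) (-(Real.exp (-(A + b ^ 2 / Ω)) / (A + b ^ 2 / Ω)) * (2 * b / Ω)) b :=
      HasDerivAt.comp (h₂ := E1) (h := fun b : ℝ => A + b ^ 2 / Ω) b (E1_deriv (x := A + b ^ 2 / Ω) (by positivity)) (hw.const_add A)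
    have hEB : HasDerivAt (fun b : ℝ => E1 (B + b ^ 2 / Ω)) (-(Real.exp (-(B + b ^ 2 / Ω)) / (B + b ^ 2 / Ω)) * (2 * b / Ω)) b :=
      HasDerivAt.comp (h₂ := E1) (h := fun b : ℝ => B + b ^ 2 / Ω) b (E1_deriv (x := B + b ^ 2 / Ω) (by positivity)) (hw.const_add B)
    refine (((hL.mul hEx).neg.sub (hEA.const_mul (Real.exp A))).add (hEB.const_mul (Real.exp B))).congr_deriv ?_
    have x1 : Real.exp (-(A + b ^ 2 / Ω)) = (Real.exp A)⁻¹ * Real.exp (-b ^ 2 / Ω) := by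
      rw [← Real.exp_neg, ← Real.exp_add]; congr 1; ring
    have x2 : Real.exp (-(B + b ^ 2 / Ω)) = (Real.exp B)⁻¹ * Real.exp (-b ^ 2 / Ω) := by
      rw [← Real.exp_neg, ← Real.exp_add]; congr 1; ring
    rw [x1, x2]
    have y1 : A + b ^ 2 / Ω = ((ζ * α₁ + α₂) * b ^ 2 + σ ^ 2) / (Ω * (ζ * α₁ + α₂)) := by
      rw [hA, hγ]; field_simp; ring
    have y2 : B + b ^ 2 / Ω = (ζ * α₁ * b ^ 2 + σ ^ 2) / (Ω * (ζ * α₁)) := by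
      rw [hB, hγ]; field_simp; ring
    have y3 : 1 + α₂ * b ^ 2 / (ζ * α₁ * b ^ 2 + σ ^ 2) = ((ζ * α₁ + α₂) * b ^ 2 + σ ^ 2) / (ζ * α₁ * b ^ 2 + σ ^ 2) := by
      field_simp; ring
    rw [y1, y2]
    generalize hLg : Real.log (1 + α₂ * b ^ 2 / (ζ * α₁ * b ^ 2 + σ ^ 2)) = L
    rw [y3]
    have hC : 0 < (ζ * α₁ + α₂) * b ^ 2 + σ ^ 2 := by positivity
    have hEA0 := Real.exp_pos A
    have hEB0 := Real.exp_pos B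
    generalize Real.exp A = EA at *
    generalize Real.exp B = EB at *
    generalize Real.exp (-b ^ 2 / Ω) = X at *
    field_simp
    ring
  · intro b hb
    have hb' : 0 < b := hb
    have : 0 ≤ Real.log (1 + α₂ * b ^ 2 / (ζ * α₁ * b ^ 2 + σ ^ 2)) :=
      Real.log_nonneg (le_add_of_nonneg_right (by positivity))
    positivity
  · have hw : Tendsto (fun b : ℝ => b ^ 2 / Ω) atTop atTop :=
      (tendsto_pow_atTop (by norm_num)).atTop_div_const hΩ
    have tA := (E1_lim.comp (tendsto_atTop_add_const_left _ A hw)).const_mul (Real.exp A)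
    have tB := (E1_lim.comp (tendsto_atTop_add_const_left _ B hw)).const_mul (Real.exp B)
    have tX : Tendsto (fun b : ℝ => Real.exp (-b ^ 2 / Ω)) atTop (nhds 0) := by
      have := Real.tendsto_exp_neg_atTop_nhds_zero.comp hw
      refine this.congr fun b => ?_
      simp [neg_div]
    have tL : Tendsto (fun b : ℝ => Real.log (1 + α₂ * b ^ 2 / (ζ * α₁ * b ^ 2 + σ ^ 2)) * Real.exp (-b ^ 2 / Ω)) atTop (nhds 0) := by
      have tc := tX.const_mul (α₂ / (ζ * α₁))
      rw [mul_zero] at tc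
      refine squeeze_zero (fun b => ?_) (fun b => ?_) tc
      · have : 0 ≤ Real.log (1 + α₂ * b ^ 2 / (ζ * α₁ * b ^ 2 + σ ^ 2)) :=
          Real.log_nonneg (le_add_of_nonneg_right (by positivity))
        positivity
      · gcongr
        have hD : 0 < ζ * α₁ * b ^ 2 + σ ^ 2 := by positivity
        have l1 := Real.log_le_sub_one_of_pos (x := 1 + α₂ * b ^ 2 / (ζ * α₁ * b ^ 2 + σ ^ 2)) (by positivity)
        have l2 : α₂ * b ^ 2 / (ζ * α₁ * b ^ 2 + σ ^ 2) ≤ α₂ / (ζ * α₁) := by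
          rw [div_le_div_iff₀ hD (by positivity)]
          have : 0 ≤ α₂ * σ ^ 2 := by positivity
          linarith
        linarith
    have := (tL.neg.sub tA).add tB
    simpa using this
end

section
/- (QPSK success-conditioned real-noise marginal, nonnegative argument.) Let Ω > 0, σ > 0, λ_i > 0, λ_j > 0, set γ̄ = Ω/σ² and μ_j = √(λ_j²γ̄/(λ_j²γ̄ + 2)). Then for every w_R ≥ 0, ∫_{-∞}^∞ (1/(σ√(2π))) e^{-t²/(2σ²)} · exp( − (max(0, −w_R/λ_i, −t/λ_j))² / Ω ) dt = (1 + μ_j)/2. Hence the unnormalized marginal density of the real part of the success-conditioned QPSK noise is f_{N_R}(w_R)·(1 + μ_j)/2 for w_R ≥ 0. -/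
open MeasureTheory Real Filter Set

/-- QPSK success-conditioned real-noise marginal, nonnegative argument. -/
theorem qpsk_noise_marginal_nonneg (Ω σ li lj γbar μj : ℝ)
    (hΩ : 0 < Ω) (hσ : 0 < σ) (hli : 0 < li) (hlj : 0 < lj)
    (hγ : γbar = Ω / σ ^ 2)
    (hμj : μj = Real.sqrt (lj ^ 2 * γbar / (lj ^ 2 * γbar + 2))) :
    ∀ wR : ℝ, 0 ≤ wR →
      (∫ t : ℝ, gaussPDF σ t *
          Real.exp (-(max (max 0 (-wR / li)) (-t / lj)) ^ 2 / Ω))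
        = (1 + μj) / 2 := by
  intro wR hwR
  have h0 : max 0 (-wR / li) = 0 :=
    max_eq_left (div_nonpos_of_nonpos_of_nonneg (by linarith) hli.le)
  rw [h0]
  set c : ℝ := (σ * Real.sqrt (2 * Real.pi))⁻¹ with hc
  set b1 : ℝ := 1 / (2 * σ ^ 2) with hb1
  set b2 : ℝ := 1 / (2 * σ ^ 2) + 1 / (lj ^ 2 * Ω) with hb2
  have hb1p : 0 < b1 := by positivity
  have hb2p : 0 < b2 := by positivity
  have e1 : ∀ t ∈ Ioi (0:ℝ), gaussPDF σ t * Real.exp (-(max 0 (-t / lj)) ^ 2 / Ω)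
      = c * Real.exp (-b1 * t ^ 2) := by
    intro t ht
    have : max 0 (-t / lj) = 0 :=
      max_eq_left (div_nonpos_of_nonpos_of_nonneg (by simpa using (le_of_lt ht)) hlj.le)
    rw [this, gaussPDF, hb1]
    simp only [ne_eq, OfNat.ofNat_ne_zero, not_false_eq_true, zero_pow, neg_zero, zero_div,
      Real.exp_zero, mul_one]
    congr 2
    ring
  have e2 : ∀ t ∈ Iic (0:ℝ), gaussPDF σ t * Real.exp (-(max 0 (-t / lj)) ^ 2 / Ω)
      = c * Real.exp (-b2 * t ^ 2) := by
    intro t ht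
    have : max 0 (-t / lj) = -t / lj :=
      max_eq_right (div_nonneg (by simpa using ht) hlj.le)
    rw [this, gaussPDF, hb2, mul_assoc, ← Real.exp_add]
    congr 2
    field_simp
    ring
  have i1 : IntegrableOn (fun t => gaussPDF σ t * Real.exp (-(max 0 (-t / lj)) ^ 2 / Ω))
      (Ioi 0) :=
    ((integrable_exp_neg_mul_sq hb1p).const_mul c).integrableOn.congr_fun
      (fun t ht => (e1 t ht).symm) measurableSet_Ioi
  have i2 : IntegrableOn (fun t => gaussPDF σ t * Real.exp (-(max 0 (-t / lj)) ^ 2 / Ω))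
      (Iic 0) :=
    ((integrable_exp_neg_mul_sq hb2p).const_mul c).integrableOn.congr_fun
      (fun t ht => (e2 t ht).symm) measurableSet_Iic
  rw [← intervalIntegral.integral_Iic_add_Ioi i2 i1, setIntegral_congr_fun measurableSet_Ioi e1,
    setIntegral_congr_fun measurableSet_Iic e2, integral_const_mul, integral_const_mul,
    integral_gaussian_Ioi]
  have hI : ∫ t in Iic (0:ℝ), Real.exp (-b2 * t ^ 2) = √(π / b2) / 2 := by
    rw [← integral_gaussian_Ioi]
    have := integral_comp_neg_Ioi (0:ℝ) (fun t => Real.exp (-b2 * t ^ 2))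
    simpa using this.symm
  rw [hI]
  have hcs : c = √(1 / (2 * π * σ ^ 2)) := by
    rw [hc, Real.sqrt_div zero_le_one, Real.sqrt_mul (x := 2 * π) (by positivity) (σ ^ 2), Real.sqrt_sq hσ.le,
      Real.sqrt_one, one_div, mul_comm σ]
  have k1 : c * √(π / b1) = 1 := by
    rw [hcs, ← Real.sqrt_mul (by positivity), Real.sqrt_eq_one, hb1]
    field_simp
  have k2 : c * √(π / b2) = μj := by
    rw [hcs, ← Real.sqrt_mul (by positivity), hμj, hγ, hb2]
    congr 1
    field_simp
    try ring
  linear_combination k1 / 2 + k2 / 2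
end

section
/- (QPSK success-conditioned real-noise marginal, negative argument.) Let Ω > 0, σ > 0, λ_i > 0, λ_j > 0, set γ̄ = Ω/σ², χ_j = λ_j/σ, and μ_j = √(λ_j²γ̄/(λ_j²γ̄ + 2)). Then for every w_R < 0, ∫_{-∞}^∞ (1/(σ√(2π))) e^{-t²/(2σ²)} · exp( − (max(0, −w_R/λ_i, −t/λ_j))² / Ω ) dt = μ_j·Φ( χ_j w_R/(λ_i μ_j) ) + e^{-w_R²/(λ_i²Ω)}·Φ( −χ_j w_R/λ_i ). Hence the unnormalized marginal density of the real part of the success-conditioned QPSK noise is f_{N_R}(w_R)·[μ_j Φ(χ_j w_R/(λ_i μ_j)) + e^{-w_R²/(λ_i²Ω)} Φ(−χ_j w_R/λ_i)] for w_R < 0. -/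
open MeasureTheory Real Filter Set

lemma aux_Ioi (s a : ℝ) (hs : 0 < s) :
    ∫ t in Set.Ioi a, gaussPDF s t = Phi (-(a / s)) := by
  unfold Phi gaussPDF
  have h1 := integral_comp_neg_Iic (-(a / s))
    (fun t : ℝ => (Real.sqrt (2 * Real.pi))⁻¹ * Real.exp (-t ^ 2 / 2))
  simp only [neg_neg, neg_sq] at h1
  have h2 := integral_comp_mul_left_Ioi
    (fun t : ℝ => (Real.sqrt (2 * Real.pi))⁻¹ * Real.exp (-t ^ 2 / 2)) a (inv_pos.mpr hs)
  rw [h1, div_eq_inv_mul]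
  have h3 : ∫ t in Set.Ioi (s⁻¹ * a), (Real.sqrt (2 * Real.pi))⁻¹ * Real.exp (-t ^ 2 / 2)
      = s⁻¹ * ∫ t in Set.Ioi a, (Real.sqrt (2 * Real.pi))⁻¹ * Real.exp (-(s⁻¹ * t) ^ 2 / 2) := by
    rw [h2, inv_inv, smul_eq_mul, inv_mul_cancel_left₀ hs.ne']
  rw [h3, ← integral_const_mul]
  congr 1
  ext t
  rw [mul_inv, mul_assoc]
  congr 3
  field_simp

lemma aux_Iic (s a : ℝ) (hs : 0 < s) :
    ∫ t in Set.Iic a, gaussPDF s t = Phi (a / s) := by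
  have h := integral_comp_neg_Iic a (gaussPDF s)
  have h' : ∀ t, gaussPDF s (-t) = gaussPDF s t := by
    intro t; simp [gaussPDF]
  simp only [h'] at h
  rw [h, aux_Ioi s (-a) hs]
  congr 1
  ring

lemma aux_int_s17 (s : ℝ) (hs : 0 < s) : Integrable (gaussPDF s) := by
  unfold gaussPDF
  have h := integrable_exp_neg_mul_sq (b := 1 / (2 * s ^ 2)) (by positivity)
  refine (h.congr (Filter.Eventually.of_forall fun t => ?_)).const_mul _
  show Real.exp _ = Real.exp _
  congr 1
  ring

/-- QPSK success-conditioned real-noise marginal, negative argument. -/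
theorem qpsk_noise_marginal_neg (Ω σ li lj γbar χj μj : ℝ)
    (hΩ : 0 < Ω) (hσ : 0 < σ) (hli : 0 < li) (hlj : 0 < lj)
    (hγ : γbar = Ω / σ ^ 2) (hχ : χj = lj / σ)
    (hμj : μj = Real.sqrt (lj ^ 2 * γbar / (lj ^ 2 * γbar + 2))) :
    ∀ wR : ℝ, wR < 0 →
      (∫ t : ℝ, gaussPDF σ t *
          Real.exp (-(max (max 0 (-wR / li)) (-t / lj)) ^ 2 / Ω))
        = μj * Phi (χj * wR / (li * μj))
          + Real.exp (-wR ^ 2 / (li ^ 2 * Ω)) * Phi (-χj * wR / li) := by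
  intro wR hw
  have hμpos : 0 < μj := by
    rw [hμj, hγ]; positivity
  have hμ2 : μj ^ 2 = lj ^ 2 * Ω / (lj ^ 2 * Ω + 2 * σ ^ 2) := by
    rw [hμj, hγ, Real.sq_sqrt (by positivity)]
    field_simp
  have hinv : 1 / (μj ^ 2) = 1 + 2 * σ ^ 2 / (lj ^ 2 * Ω) := by
    rw [hμ2]; field_simp
  have hsp : 0 < σ * μj := by positivity
  have hw0 : 0 < -wR / li := div_pos (by linarith) hli
  have hm0 : max 0 (-wR / li) = -wR / li := max_eq_right hw0.le
  have hl : Set.EqOn (fun t => gaussPDF σ t *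
      Real.exp (-(max (max 0 (-wR / li)) (-t / lj)) ^ 2 / Ω))
      (fun t => μj * gaussPDF (σ * μj) t) (Set.Iic (lj * wR / li)) := by
    intro t ht
    have ht' : t ≤ lj * wR / li := ht
    have hm : max (max 0 (-wR / li)) (-t / lj) = -t / lj := by
      rw [hm0]
      apply max_eq_right
      rw [div_le_div_iff₀ hli hlj]
      rw [le_div_iff₀ hli] at ht'
      linarith
    show _ * Real.exp (-(max (max 0 (-wR / li)) (-t / lj)) ^ 2 / Ω) = _
    rw [hm]
    simp only [gaussPDF]
    rw [mul_assoc, ← Real.exp_add, ← mul_assoc]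
    congr 1
    · field_simp
    · congr 1
      have : -t ^ 2 / (2 * (σ * μj) ^ 2) = -t ^ 2 / (2 * σ ^ 2) * (1 / μj ^ 2) := by
        field_simp
      rw [this, hinv]
      field_simp
      try ring
  have hr : Set.EqOn (fun t => gaussPDF σ t *
      Real.exp (-(max (max 0 (-wR / li)) (-t / lj)) ^ 2 / Ω))
      (fun t => Real.exp (-wR ^ 2 / (li ^ 2 * Ω)) * gaussPDF σ t)
      (Set.Ioi (lj * wR / li)) := by
    intro t ht
    have ht' : lj * wR / li < t := ht
    have hm : max (max 0 (-wR / li)) (-t / lj) = -wR / li := by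
      rw [hm0]
      apply max_eq_left
      rw [div_le_div_iff₀ hlj hli]
      rw [div_lt_iff₀ hli] at ht'
      linarith
    show _ * Real.exp (-(max (max 0 (-wR / li)) (-t / lj)) ^ 2 / Ω) = _
    rw [hm, mul_comm]
    congr 2
    field_simp
  have i1 := (((aux_int_s17 _ hsp).const_mul μj).integrableOn
    (s := Set.Iic (lj * wR / li))).congr_fun hl.symm measurableSet_Iic
  have i2 := (((aux_int_s17 _ hσ).const_mul (Real.exp (-wR ^ 2 / (li ^ 2 * Ω)))).integrableOn
    (s := Set.Ioi (lj * wR / li))).congr_fun hr.symm measurableSet_Ioi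
  rw [← intervalIntegral.integral_Iic_add_Ioi i1 i2,
    setIntegral_congr_fun measurableSet_Iic hl, setIntegral_congr_fun measurableSet_Ioi hr,
    integral_const_mul, integral_const_mul, aux_Iic _ _ hsp, aux_Ioi _ _ hσ, hχ]
  congr 3
  · field_simp
  · field_simp
end
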